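/- arXiv:2303.11495 — 2 statements merged into one kernel-verified Lean document; each statement's English description precedes it below -/
import Mathlib

section
/- Suppose h, u solve the linearized Serre equations on [x_L, x_R] × [0, ∞) and satisfy the periodic boundary conditions: for all t ≥ 0, h(x_L,t) = h(x_R,t), u(x_L,t) = u(x_R,t), ∂u/∂x(x_L,t) = ∂u/∂x(x_R,t), and ∂²u/∂x²(x_L,t) = ∂²u/∂x²(x_R,t) (so that, by smoothness, also ∂²u/(∂x∂t) agrees at the two endpoints). Then the energy is conserved: E(t) = E(0) for all t ≥ 0. -/
open Real MeasureTheory Set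

noncomputable section

/-- Partial derivative in the spatial variable `x` (first argument). -/
def pdX (f : ℝ → ℝ → ℝ) (x t : ℝ) : ℝ := deriv (fun ξ => f ξ t) x

/-- Partial derivative in the temporal variable `t` (second argument). -/
def pdT (f : ℝ → ℝ → ℝ) (x t : ℝ) : ℝ := deriv (fun τ => f x τ) t

/-- `h, u` solve the linearized Serre equations on `[xL, xR] × [0, ∞)`:
they are sufficiently smooth and satisfy the continuity and momentum equations. -/
def SolvesSerre (g H U xL xR : ℝ) (h u : ℝ → ℝ → ℝ) : Prop :=
  ContDiff ℝ 3 (fun p : ℝ × ℝ => h p.1 p.2) ∧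
  ContDiff ℝ 3 (fun p : ℝ × ℝ => u p.1 p.2) ∧
  (∀ x ∈ Set.Icc xL xR, ∀ t : ℝ, 0 ≤ t →
    pdT h x t + pdX (fun ξ τ => H * u ξ τ + U * h ξ τ) x t = 0) ∧
  (∀ x ∈ Set.Icc xL xR, ∀ t : ℝ, 0 ≤ t →
    pdT u x t + pdX (fun ξ τ => g * h ξ τ + U * u ξ τ
      - H ^ 2 * U / 3 * pdX (pdX u) ξ τ
      - H ^ 2 / 3 * pdT (pdX u) ξ τ) x t = 0)

/-- The energy `E(t)` on the interval `[xL, xR]`. -/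
def energy (g H xL xR : ℝ) (h u : ℝ → ℝ → ℝ) (t : ℝ) : ℝ :=
  g / 2 * (∫ x in xL..xR, h x t ^ 2)
    + H / 2 * (∫ x in xL..xR, u x t ^ 2)
    + H ^ 3 / 6 * (∫ x in xL..xR, pdX u x t ^ 2)

/-- The boundary term `BT(h, u)(x, t)`. -/
def BT (g H U : ℝ) (h u : ℝ → ℝ → ℝ) (x t : ℝ) : ℝ :=
  -(g * H) * h x t * u x t - g * U / 2 * h x t ^ 2 - H * U / 2 * u x t ^ 2
    - H ^ 3 * U / 6 * pdX u x t ^ 2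
    + H ^ 3 * U / 3 * (u x t * pdX (pdX u) x t)
    + H ^ 3 / 3 * (u x t * pdT (pdX u) x t)

section PartialDerivatives

variable {f : ℝ → ℝ → ℝ}

lemma hasDerivAt_fst (hf : ContDiff ℝ 1 (fun p : ℝ × ℝ => f p.1 p.2)) (x t : ℝ) :
    HasDerivAt (fun ξ => f ξ t) (fderiv ℝ (fun p : ℝ × ℝ => f p.1 p.2) (x, t) (1, 0)) x :=
  ((hf.differentiable one_ne_zero) (x, t)).hasFDerivAt.comp_hasDerivAt (f := fun ξ => (ξ, t)) x
    ((hasDerivAt_id' x).prodMk (hasDerivAt_const x t))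

lemma hasDerivAt_snd (hf : ContDiff ℝ 1 (fun p : ℝ × ℝ => f p.1 p.2)) (x t : ℝ) :
    HasDerivAt (fun τ => f x τ) (fderiv ℝ (fun p : ℝ × ℝ => f p.1 p.2) (x, t) (0, 1)) t :=
  ((hf.differentiable one_ne_zero) (x, t)).hasFDerivAt.comp_hasDerivAt (f := fun τ => (x, τ)) t
    ((hasDerivAt_const t x).prodMk (hasDerivAt_id' t))

lemma hasDerivAt_pdX (hf : ContDiff ℝ 1 (fun p : ℝ × ℝ => f p.1 p.2)) (x t : ℝ) :
    HasDerivAt (fun ξ => f ξ t) (pdX f x t) x :=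
  (hasDerivAt_fst hf x t).differentiableAt.hasDerivAt

lemma hasDerivAt_pdT (hf : ContDiff ℝ 1 (fun p : ℝ × ℝ => f p.1 p.2)) (x t : ℝ) :
    HasDerivAt (fun τ => f x τ) (pdT f x t) t :=
  (hasDerivAt_snd hf x t).differentiableAt.hasDerivAt

lemma contDiff_pdX {m n : WithTop ℕ∞} (hf : ContDiff ℝ n (fun p : ℝ × ℝ => f p.1 p.2))
    (hmn : m + 1 ≤ n) : ContDiff ℝ m (fun p : ℝ × ℝ => pdX f p.1 p.2) := by
  have hf' := hf.of_le (le_add_self.trans hmn)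
  have : (fun p : ℝ × ℝ => pdX f p.1 p.2) =
      fun p => fderiv ℝ (fun p : ℝ × ℝ => f p.1 p.2) p (1, 0) :=
    funext fun p => (hasDerivAt_fst hf' p.1 p.2).deriv
  exact this ▸ (hf.fderiv_right hmn).clm_apply contDiff_const

lemma contDiff_pdT {m n : WithTop ℕ∞} (hf : ContDiff ℝ n (fun p : ℝ × ℝ => f p.1 p.2))
    (hmn : m + 1 ≤ n) : ContDiff ℝ m (fun p : ℝ × ℝ => pdT f p.1 p.2) := by
  have hf' := hf.of_le (le_add_self.trans hmn)
  have : (fun p : ℝ × ℝ => pdT f p.1 p.2) =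
      fun p => fderiv ℝ (fun p : ℝ × ℝ => f p.1 p.2) p (0, 1) :=
    funext fun p => (hasDerivAt_snd hf' p.1 p.2).deriv
  exact this ▸ (hf.fderiv_right hmn).clm_apply contDiff_const

/-- Differentiation under the integral sign for a `C¹` integrand on a compact interval. -/
lemma hasDerivAt_integral_pdT (hf : ContDiff ℝ 1 (fun p : ℝ × ℝ => f p.1 p.2)) (a b t : ℝ) :
    HasDerivAt (fun τ => ∫ x in a..b, f x τ) (∫ x in a..b, pdT f x t) t := by
  have hcont : Continuous fun p : ℝ × ℝ => f p.1 p.2 := hf.continuous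
  have hcont' : Continuous fun p : ℝ × ℝ => pdT f p.1 p.2 :=
    (contDiff_pdT (m := 0) hf (by simp)).continuous
  obtain ⟨C, hC⟩ := ((isCompact_uIcc (a := a) (b := b)).prod
    (isCompact_closedBall t 1)).exists_bound_of_continuousOn hcont'.continuousOn
  have hslice (τ : ℝ) : Continuous fun x => f x τ := hcont.comp (.prodMk_left τ)
  have hslice' : Continuous fun x => pdT f x t := hcont'.comp (.prodMk_left t)
  refine (intervalIntegral.hasDerivAt_integral_of_dominated_loc_of_deriv_le
    (F := fun τ x => f x τ) (F' := fun τ x => pdT f x τ) (bound := fun _ => C)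
    (Metric.closedBall_mem_nhds t one_pos) (.of_forall fun τ => (hslice τ).aestronglyMeasurable)
    ((hslice t).intervalIntegrable a b) hslice'.aestronglyMeasurable ?_ (by simp) ?_).2
  · exact .of_forall fun x hx τ hτ => hC (x, τ) ⟨uIoc_subset_uIcc hx, hτ⟩
  · exact .of_forall fun x _ τ _ => hasDerivAt_pdT hf x τ

/-- Two functions of time that agree for `t ≥ 0` have the same time derivative for `t ≥ 0`. -/
lemma pdT_eq_of_eqOn_nonneg (hf : ContDiff ℝ 1 (fun p : ℝ × ℝ => f p.1 p.2)) {x y : ℝ}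
    (hxy : ∀ t : ℝ, 0 ≤ t → f x t = f y t) {t : ℝ} (ht : 0 ≤ t) : pdT f x t = pdT f y t :=
  (uniqueDiffOn_Ici 0 t ht).eq_deriv _ (hasDerivAt_pdT hf x t).hasDerivWithinAt
    ((hasDerivAt_pdT hf y t).hasDerivWithinAt.congr hxy (hxy t ht))

end PartialDerivatives

/-- The integrand of the energy. -/
def energyDensity (g H : ℝ) (h u : ℝ → ℝ → ℝ) (x t : ℝ) : ℝ :=
  g / 2 * h x t ^ 2 + H / 2 * u x t ^ 2 + H ^ 3 / 6 * pdX u x t ^ 2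

section Serre

variable {g H U xL xR : ℝ} {h u : ℝ → ℝ → ℝ}

lemma contDiff_energyDensity (hh : ContDiff ℝ 3 (fun p : ℝ × ℝ => h p.1 p.2))
    (hu : ContDiff ℝ 3 (fun p : ℝ × ℝ => u p.1 p.2)) :
    ContDiff ℝ 1 (fun p : ℝ × ℝ => energyDensity g H h u p.1 p.2) := by
  have hh1 : ContDiff ℝ 1 (fun p : ℝ × ℝ => h p.1 p.2) := hh.of_le (by norm_num)
  have hu1 : ContDiff ℝ 1 (fun p : ℝ × ℝ => u p.1 p.2) := hu.of_le (by norm_num)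
  have hux : ContDiff ℝ 1 (fun p : ℝ × ℝ => pdX u p.1 p.2) :=
    contDiff_pdX hu (by norm_num)
  unfold energyDensity
  fun_prop

lemma energy_eq_integral_energyDensity (hh : ContDiff ℝ 3 (fun p : ℝ × ℝ => h p.1 p.2))
    (hu : ContDiff ℝ 3 (fun p : ℝ × ℝ => u p.1 p.2)) (t : ℝ) :
    energy g H xL xR h u t = ∫ x in xL..xR, energyDensity g H h u x t := by
  have hh0 : Continuous fun x => h x t := hh.continuous.comp (.prodMk_left t)
  have hu0 : Continuous fun x => u x t := hu.continuous.comp (.prodMk_left t)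
  have hux : Continuous fun x => pdX u x t :=
    (contDiff_pdX (m := 1) hu (by norm_num)).continuous.comp (.prodMk_left t)
  unfold energy energyDensity
  rw [intervalIntegral.integral_add, intervalIntegral.integral_add]
  · simp only [intervalIntegral.integral_const_mul]
  all_goals exact Continuous.intervalIntegrable (by fun_prop) _ _

/-- The local energy balance: the energy density changes at the rate of the flux `BT`. -/
lemma SolvesSerre.hasDerivAt_BT (hsol : SolvesSerre g H U xL xR h u) {x t : ℝ}
    (hx : x ∈ Icc xL xR) (ht : 0 ≤ t) :
    HasDerivAt (fun ξ => BT g H U h u ξ t) (pdT (energyDensity g H h u) x t) x := by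
  obtain ⟨hh, hu, hmass, hmom⟩ := hsol
  have hh1 : ContDiff ℝ 1 (fun p : ℝ × ℝ => h p.1 p.2) := hh.of_le (by norm_num)
  have hu1 : ContDiff ℝ 1 (fun p : ℝ × ℝ => u p.1 p.2) := hu.of_le (by norm_num)
  have hux : ContDiff ℝ 2 (fun p : ℝ × ℝ => pdX u p.1 p.2) := contDiff_pdX hu (by norm_num)
  have hux1 := hux.of_le (m := 1) (by norm_num)
  have huxx : ContDiff ℝ 1 (fun p : ℝ × ℝ => pdX (pdX u) p.1 p.2) :=
    contDiff_pdX hux (by norm_num)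
  have huxt : ContDiff ℝ 1 (fun p : ℝ × ℝ => pdT (pdX u) p.1 p.2) :=
    contDiff_pdT hux (by norm_num)
  have dh := hasDerivAt_pdX hh1 x t
  have du := hasDerivAt_pdX hu1 x t
  have dux := hasDerivAt_pdX hux1 x t
  have duxx := hasDerivAt_pdX huxx x t
  have duxt := hasDerivAt_pdX huxt x t
  have mass : pdT h x t + (H * pdX u x t + U * pdX h x t) = 0 := by
    rw [← hmass x hx t ht]
    exact congrArg _ ((du.const_mul H).add (dh.const_mul U)).deriv.symm
  have mom : pdT u x t + (g * pdX h x t + U * pdX u x t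
      - H ^ 2 * U / 3 * pdX (pdX (pdX u)) x t - H ^ 2 / 3 * pdX (pdT (pdX u)) x t) = 0 := by
    rw [← hmom x hx t ht]
    exact congrArg _ ((((dh.const_mul g).add (du.const_mul U)).sub
      (duxx.const_mul (H ^ 2 * U / 3))).sub (duxt.const_mul (H ^ 2 / 3))).deriv.symm
  have density : pdT (energyDensity g H h u) x t = g * h x t * pdT h x t
      + H * u x t * pdT u x t + H ^ 3 / 3 * pdX u x t * pdT (pdX u) x t := by
    refine HasDerivAt.deriv (((((hasDerivAt_pdT hh1 x t).pow 2).const_mul (g / 2)).add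
      (((hasDerivAt_pdT hu1 x t).pow 2).const_mul (H / 2))).add
      (((hasDerivAt_pdT hux1 x t).pow 2).const_mul (H ^ 3 / 6)) |>.congr_deriv ?_)
    push_cast
    ring
  refine HasDerivAt.congr_deriv ((((((dh.const_mul (-(g * H))).mul du).sub
    ((dh.pow 2).const_mul (g * U / 2))).sub ((du.pow 2).const_mul (H * U / 2))).sub
    ((dux.pow 2).const_mul (H ^ 3 * U / 6))).add ((du.mul duxx).const_mul (H ^ 3 * U / 3)) |>.add
    ((du.mul duxt).const_mul (H ^ 3 / 3))) ?_
  rw [density]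
  push_cast
  linear_combination -(g * h x t) * mass - H * u x t * mom

/-- The energy changes only through the boundary flux. -/
lemma SolvesSerre.hasDerivAt_energy (hsol : SolvesSerre g H U xL xR h u) (hx : xL ≤ xR) {t : ℝ}
    (ht : 0 ≤ t) :
    HasDerivAt (energy g H xL xR h u) (BT g H U h u xR t - BT g H U h u xL t) t := by
  have he := contDiff_energyDensity (g := g) (H := H) hsol.1 hsol.2.1
  rw [funext (energy_eq_integral_energyDensity hsol.1 hsol.2.1),
    ← intervalIntegral.integral_eq_sub_of_hasDerivAt
      (fun x hxm => hsol.hasDerivAt_BT (uIcc_of_le hx ▸ hxm) ht)]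
  · exact hasDerivAt_integral_pdT he xL xR t
  · exact ((contDiff_pdT (m := 0) he (by simp)).continuous.comp
      (.prodMk_left t)).intervalIntegrable _ _

end Serre

/-- Theorem 3.3: with periodic boundary conditions the energy is conserved. -/
theorem energy_conservation_periodic (g H U xL xR : ℝ) (hg : 0 < g) (hH : 0 < H)
    (hx : xL < xR) (h u : ℝ → ℝ → ℝ) (hsol : SolvesSerre g H U xL xR h u)
    (hper_h : ∀ t : ℝ, 0 ≤ t → h xL t = h xR t)
    (hper_u : ∀ t : ℝ, 0 ≤ t → u xL t = u xR t)
    (hper_ux : ∀ t : ℝ, 0 ≤ t → pdX u xL t = pdX u xR t)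
    (hper_uxx : ∀ t : ℝ, 0 ≤ t → pdX (pdX u) xL t = pdX (pdX u) xR t) :
    ∀ t : ℝ, 0 ≤ t → energy g H xL xR h u t = energy g H xL xR h u 0 := by
  have hux : ContDiff ℝ 1 (fun p : ℝ × ℝ => pdX u p.1 p.2) :=
    contDiff_pdX hsol.2.1 (by norm_num)
  have hderiv (t : ℝ) (ht : 0 ≤ t) : HasDerivAt (energy g H xL xR h u) 0 t := by
    refine (hsol.hasDerivAt_energy hx.le ht).congr_deriv ?_
    simp only [BT, hper_h t ht, hper_u t ht, hper_ux t ht, hper_uxx t ht,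
      pdT_eq_of_eqOn_nonneg hux hper_ux ht, sub_self]
  intro t ht
  exact constant_of_has_deriv_right_zero
    (fun s hs => (hderiv s hs.1).continuousAt.continuousWithinAt)
    (fun s hs => (hderiv s hs.1).hasDerivWithinAt) t ⟨ht, le_rfl⟩
end
end

section
/- Let g, H > 0 and U ∈ ℝ. Let h, u : [0, ∞) → ℝⁿ be differentiable and satisfy the single-element scheme with left-boundary SAT penalties: h'(t) = −D(H u + U h) − (U/2)M⁻¹e_L e_Lᵀ h − H·M⁻¹e_L e_Lᵀ u, and u'(t) = −D(g h + U u − (H²U/3)D²u − (H²/3)D u'(t)) − (H²/3)M⁻¹Dᵀe_L e_Lᵀ u'(t) − (H²/3)M⁻¹e_L e_Lᵀ M⁻¹ e_L e_Lᵀ u'(t) − (U/2)M⁻¹e_L e_Lᵀ u − (H²U/6)M⁻¹Dᵀe_L e_Lᵀ D u + (H²U/3)M⁻¹(Dᵀ)² e_L e_Lᵀ u. Assume the contributions from the right boundary vanish for all t ≥ 0: hₙ(t) = 0, uₙ(t) = 0 and (D u(t))ₙ = 0. Define D̃ = D + M⁻¹e_L e_Lᵀ and the discrete energy E(t) = (g/2)·h(t)ᵀM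 h(t) + (H/2)·u(t)ᵀM u(t) + (H³/6)·(D̃u(t))ᵀM(D̃u(t)). Then the discrete energy is conserved: E(t) = E(0) for all t ≥ 0. -/
open Matrix

noncomputable section

/-- The SBP boundary matrix `B = diag(-1, 0, …, 0, 1)` in dimension `n + 2`. -/
def Bbnd (n : ℕ) : Matrix (Fin (n + 2)) (Fin (n + 2)) ℝ :=
  Matrix.diagonal (fun i => if i = 0 then (-1 : ℝ) else if i = Fin.last (n + 1) then 1 else 0)

/-- The first coordinate vector `e_L = (1, 0, …, 0)ᵀ`. -/
def eVL (n : ℕ) : Fin (n + 2) → ℝ := fun i => if i = 0 then 1 else 0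

/-- The last coordinate vector `e_R = (0, …, 0, 1)ᵀ`. -/
def eVR (n : ℕ) : Fin (n + 2) → ℝ := fun i => if i = Fin.last (n + 1) then 1 else 0

theorem HasDerivAt.matrix_mulVec_const {m n : Type*} [Fintype m] [Fintype n]
    (A : Matrix m n ℝ) {f : ℝ → n → ℝ} {f' : n → ℝ} {t : ℝ} (hf : HasDerivAt f f' t) :
    HasDerivAt (fun s => A *ᵥ f s) (A *ᵥ f') t := by
  rw [hasDerivAt_pi] at hf ⊢
  intro i
  simp only [mulVec, dotProduct]
  exact HasDerivAt.fun_sum fun j _ => (hf j).const_mul (A i j)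

theorem HasDerivAt.vec_dotProduct {n : Type*} [Fintype n] {f k : ℝ → n → ℝ} {f' k' : n → ℝ}
    {t : ℝ} (hf : HasDerivAt f f' t) (hk : HasDerivAt k k' t) :
    HasDerivAt (fun s => f s ⬝ᵥ k s) (f' ⬝ᵥ k t + f t ⬝ᵥ k') t := by
  rw [hasDerivAt_pi] at hf hk
  simp only [dotProduct, ← Finset.sum_add_distrib]
  exact HasDerivAt.fun_sum fun j _ => (hf j).mul (hk j)

theorem Matrix.IsSymm.dotProduct_mulVec_comm {n : Type*} [Fintype n] {A : Matrix n n ℝ}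
    (hA : A.IsSymm) (x y : n → ℝ) : x ⬝ᵥ (A *ᵥ y) = y ⬝ᵥ (A *ᵥ x) := by
  rw [dotProduct_mulVec, ← mulVec_transpose, hA.eq, dotProduct_comm]

theorem Matrix.IsSymm.hasDerivAt_quadratic {n : Type*} [Fintype n] {A : Matrix n n ℝ}
    (hA : A.IsSymm) {f : ℝ → n → ℝ} {f' : n → ℝ} {t : ℝ} (hf : HasDerivAt f f' t) :
    HasDerivAt (fun s => f s ⬝ᵥ (A *ᵥ f s)) (2 * (f t ⬝ᵥ (A *ᵥ f'))) t := by
  convert hf.vec_dotProduct (hf.matrix_mulVec_const A) using 1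
  rw [hA.dotProduct_mulVec_comm f' (f t)]
  ring

theorem dotProduct_eVL {n : ℕ} (x : Fin (n + 2) → ℝ) : x ⬝ᵥ eVL n = x 0 := by
  simp [dotProduct, eVL]

theorem eVL_dotProduct {n : ℕ} (x : Fin (n + 2) → ℝ) : eVL n ⬝ᵥ x = x 0 := by
  rw [dotProduct_comm, dotProduct_eVL]

theorem dotProduct_Bbnd_mulVec {n : ℕ} (x y : Fin (n + 2) → ℝ) :
    x ⬝ᵥ (Bbnd n *ᵥ y) = x (Fin.last (n + 1)) * y (Fin.last (n + 1)) - x 0 * y 0 := by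
  have h (i : Fin (n + 2)) : x i * ((if i = 0 then (-1 : ℝ) else
      if i = Fin.last (n + 1) then 1 else 0) * y i) =
      (if i = Fin.last (n + 1) then x i * y i else 0) - (if i = 0 then x i * y i else 0) := by
    by_cases h0 : i = 0
    · subst h0
      simp [Fin.ext_iff]
    · by_cases h1 : i = Fin.last (n + 1) <;> simp [h0, h1]
  simp only [dotProduct, Bbnd, mulVec_diagonal, h, Finset.sum_sub_distrib]
  simp

/-- Summation by parts in bilinear form. -/
theorem sbp_dotProduct {n : ℕ} {M D : Matrix (Fin (n + 2)) (Fin (n + 2)) ℝ}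
    (hSBP : M * D + Dᵀ * M = Bbnd n) (x y : Fin (n + 2) → ℝ) :
    x ⬝ᵥ (M *ᵥ (D *ᵥ y)) = -((D *ᵥ x) ⬝ᵥ (M *ᵥ y))
      + x (Fin.last (n + 1)) * y (Fin.last (n + 1)) - x 0 * y 0 := by
  have h := dotProduct_Bbnd_mulVec x y
  rw [← hSBP, add_mulVec, dotProduct_add, ← mulVec_mulVec, ← mulVec_mulVec,
    dotProduct_mulVec x Dᵀ, vecMul_transpose] at h
  linarith

/-- Theorem 4.8: the single-element scheme with left-boundary SAT penalties
conserves the discrete energy (right boundary contributions being assumed to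
vanish). -/
theorem left_boundary_sat_energy_conservation (n : ℕ)
    (M D : Matrix (Fin (n + 2)) (Fin (n + 2)) ℝ)
    (d : Fin (n + 2) → ℝ) (hM : M = Matrix.diagonal d) (hd : ∀ i, 0 < d i)
    (hSBP : M * D + Dᵀ * M = Bbnd n)
    (g H U : ℝ) (hg : 0 < g) (hH : 0 < H)
    (hv uv : ℝ → Fin (n + 2) → ℝ)
    (hhv : Differentiable ℝ hv) (huv : Differentiable ℝ uv)
    (hschemeh : ∀ t : ℝ, 0 ≤ t →
      deriv hv t = -(D *ᵥ (H • uv t + U • hv t))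
        - (U / 2) • ((M⁻¹ * vecMulVec (eVL n) (eVL n)) *ᵥ hv t)
        - H • ((M⁻¹ * vecMulVec (eVL n) (eVL n)) *ᵥ uv t))
    (hschemeu : ∀ t : ℝ, 0 ≤ t →
      deriv uv t = -(D *ᵥ (g • hv t + U • uv t
            - (H ^ 2 * U / 3) • ((D ^ 2) *ᵥ uv t)
            - (H ^ 2 / 3) • (D *ᵥ deriv uv t)))
        - (H ^ 2 / 3) • ((M⁻¹ * Dᵀ * vecMulVec (eVL n) (eVL n)) *ᵥ deriv uv t)
        - (H ^ 2 / 3) • ((M⁻¹ * vecMulVec (eVL n) (eVL n) * M⁻¹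
            * vecMulVec (eVL n) (eVL n)) *ᵥ deriv uv t)
        - (U / 2) • ((M⁻¹ * vecMulVec (eVL n) (eVL n)) *ᵥ uv t)
        - (H ^ 2 * U / 6) • ((M⁻¹ * Dᵀ * vecMulVec (eVL n) (eVL n) * D) *ᵥ uv t)
        + (H ^ 2 * U / 3) • ((M⁻¹ * (Dᵀ) ^ 2 * vecMulVec (eVL n) (eVL n)) *ᵥ uv t))
    (hbd_h : ∀ t : ℝ, 0 ≤ t → hv t (Fin.last (n + 1)) = 0)
    (hbd_u : ∀ t : ℝ, 0 ≤ t → uv t (Fin.last (n + 1)) = 0)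
    (hbd_Du : ∀ t : ℝ, 0 ≤ t → (D *ᵥ uv t) (Fin.last (n + 1)) = 0)
    (E : ℝ → ℝ)
    (hE : ∀ t : ℝ, E t = g / 2 * (hv t ⬝ᵥ (M *ᵥ hv t)) + H / 2 * (uv t ⬝ᵥ (M *ᵥ uv t))
      + H ^ 3 / 6 * (((D + M⁻¹ * vecMulVec (eVL n) (eVL n)) *ᵥ uv t)
          ⬝ᵥ (M *ᵥ ((D + M⁻¹ * vecMulVec (eVL n) (eVL n)) *ᵥ uv t)))) :
    ∀ t : ℝ, 0 ≤ t → E t = E 0 := by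
  subst hM
  set M := Matrix.diagonal d with hMdef
  have hMsymm : M.IsSymm := isSymm_diagonal d
  have hMinv : M * M⁻¹ = 1 := by
    refine mul_nonsing_inv _ ?_
    rw [hMdef, det_diagonal]
    exact (Finset.prod_ne_zero_iff.mpr fun i _ => (hd i).ne').isUnit
  have hcancel (x : Fin (n + 2) → ℝ) : M *ᵥ (M⁻¹ *ᵥ x) = x := by
    rw [mulVec_mulVec, hMinv, one_mulVec]
  have hadj (x y : Fin (n + 2) → ℝ) : x ⬝ᵥ (Dᵀ *ᵥ y) = (D *ᵥ x) ⬝ᵥ y := by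
    rw [dotProduct_mulVec, vecMul_transpose]
  have hrank (x : Fin (n + 2) → ℝ) : vecMulVec (eVL n) (eVL n) *ᵥ x = x 0 • eVL n := by
    rw [vecMulVec_mulVec, eVL_dotProduct]
    simp
  have hwM (y : Fin (n + 2) → ℝ) : (M⁻¹ *ᵥ eVL n) ⬝ᵥ (M *ᵥ y) = y 0 := by
    rw [hMsymm.dotProduct_mulVec_comm, hcancel, dotProduct_eVL]
  have hsbp := sbp_dotProduct hSBP
  have hderiv : ∀ t : ℝ, 0 ≤ t → HasDerivAt E 0 t := by
    intro t ht
    have hh := (hhv t).hasDerivAt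
    have hu := (huv t).hasDerivAt
    have key := (((hMsymm.hasDerivAt_quadratic hh).const_mul (g / 2)).add
      ((hMsymm.hasDerivAt_quadratic hu).const_mul (H / 2))).add
      ((hMsymm.hasDerivAt_quadratic (hu.matrix_mulVec_const
        (D + M⁻¹ * vecMulVec (eVL n) (eVL n)))).const_mul (H ^ 3 / 6))
    refine (key.congr_of_eventuallyEq (.of_forall hE)).congr_deriv ?_
    have hnh := hbd_h t ht
    have hnu := hbd_u t ht
    have hnDu := hbd_Du t ht
    have eqh := congrArg (fun v => hv t ⬝ᵥ (M *ᵥ v)) (hschemeh t ht)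
    have equ := congrArg (fun v => uv t ⬝ᵥ (M *ᵥ v)) (hschemeu t ht)
    generalize deriv hv t = h' at *
    generalize deriv uv t = u' at *
    generalize hv t = h at *
    generalize uv t = u at *
    simp only [pow_two, ← mulVec_mulVec, add_mulVec, mulVec_add, mulVec_sub, mulVec_neg,
      mulVec_smul, dotProduct_add, dotProduct_sub, dotProduct_neg, dotProduct_smul,
      add_dotProduct, smul_dotProduct, hrank, hcancel, hadj, hwM, dotProduct_eVL,
      smul_eq_mul] at eqh equ ⊢
    have s1 := hsbp h h
    have s2 := hsbp u h
    have s3 := hsbp u u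
    have s4 := hsbp u (D *ᵥ (D *ᵥ u))
    have s5 := hsbp (D *ᵥ u) (D *ᵥ u)
    have s6 := hsbp u (D *ᵥ u')
    have c1 := hMsymm.dotProduct_mulVec_comm (D *ᵥ h) h
    have c2 := hMsymm.dotProduct_mulVec_comm (D *ᵥ u) h
    have c3 := hMsymm.dotProduct_mulVec_comm (D *ᵥ u) u
    have c5 := hMsymm.dotProduct_mulVec_comm (D *ᵥ (D *ᵥ u)) (D *ᵥ u)
    rw [hnh, c1] at s1
    rw [hnu, c2] at s2
    rw [hnu, c3] at s3
    rw [hnu] at s4 s6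
    rw [hnDu, c5] at s5
    linear_combination g * eqh + H * equ - g * U / 2 * s1 - g * H * s2 - H * U / 2 * s3
      + H ^ 3 * U / 3 * s4 - H ^ 3 * U / 6 * s5 + H ^ 3 / 3 * s6
  exact fun t ht => constant_of_has_deriv_right_zero
    (fun s hs => (hderiv s hs.1).continuousAt.continuousWithinAt)
    (fun s hs => (hderiv s hs.1).hasDerivWithinAt) t ⟨ht, le_rfl⟩
end
end
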